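/- arXiv:1907.04383 — 3 statements merged into one kernel-verified Lean document; each statement's English description precedes it below -/
import Mathlib

section
/- Let (𝐀,𝐁) be a promise template over finite domains that has block-symmetric polymorphisms of arbitrarily high width, i.e., for every N there exist L, a partition of [L] into blocks each of size at least N, and a polymorphism of (𝐀,𝐁) of arity L block-symmetric with respect to that partition. Let 𝐗 be any instance. If there exist a BLP solution (w,p) for (𝐗,𝐀) and an affine solution (r,q) refining (w,p), then there exists a homomorphism from 𝐗 to 𝐁. -/
/-- `σ` is a homomorphism between the relational structures given by `RX` and `RA`. -/
def IsHom {ι : Type} {ar : ι → ℕ} {X A : Type}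
    (RX : ∀ R : ι, Finset (Fin (ar R) → X))
    (RA : ∀ R : ι, Finset (Fin (ar R) → A)) (σ : X → A) : Prop :=
  ∀ R : ι, ∀ t ∈ RX R, (fun k => σ (t k)) ∈ RA R

/-- `(w, p)` is a solution of the basic LP relaxation of the instance `RX` over `RA`. -/
def IsBLPSol {ι : Type} {ar : ι → ℕ} {X A : Type} [Fintype A] [DecidableEq A]
    (RX : ∀ R : ι, Finset (Fin (ar R) → X))
    (RA : ∀ R : ι, Finset (Fin (ar R) → A))
    (w : X → A → ℚ)
    (p : ∀ R : ι, (Fin (ar R) → X) → (Fin (ar R) → A) → ℚ) : Prop :=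
  (∀ i a, 0 ≤ w i a) ∧
  (∀ R : ι, ∀ xb ∈ RX R, ∀ y ∈ RA R, 0 ≤ p R xb y) ∧
  (∀ i, ∑ a, w i a = 1) ∧
  (∀ R : ι, ∀ xb ∈ RX R, ∑ y ∈ RA R, p R xb y = 1) ∧
  (∀ R : ι, ∀ xb ∈ RX R, ∀ (k : Fin (ar R)) (a : A),
    ∑ y ∈ (RA R).filter (fun y => y k = a), p R xb y = w (xb k) a)

/-- `(r, q)` is a solution of the affine (integral) relaxation of the instance `RX` over `RA`. -/
def IsAffSol {ι : Type} {ar : ι → ℕ} {X A : Type} [Fintype A] [DecidableEq A]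
    (RX : ∀ R : ι, Finset (Fin (ar R) → X))
    (RA : ∀ R : ι, Finset (Fin (ar R) → A))
    (r : X → A → ℤ)
    (q : ∀ R : ι, (Fin (ar R) → X) → (Fin (ar R) → A) → ℤ) : Prop :=
  (∀ i, ∑ a, r i a = 1) ∧
  (∀ R : ι, ∀ xb ∈ RX R, ∑ y ∈ RA R, q R xb y = 1) ∧
  (∀ R : ι, ∀ xb ∈ RX R, ∀ (k : Fin (ar R)) (a : A),
    ∑ y ∈ (RA R).filter (fun y => y k = a), q R xb y = r (xb k) a)

/-- The affine solution `(r, q)` refines the BLP solution `(w, p)`. -/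
def Refines {ι : Type} {ar : ι → ℕ} {X A : Type}
    (RX : ∀ R : ι, Finset (Fin (ar R) → X))
    (RA : ∀ R : ι, Finset (Fin (ar R) → A))
    (w : X → A → ℚ)
    (p : ∀ R : ι, (Fin (ar R) → X) → (Fin (ar R) → A) → ℚ)
    (r : X → A → ℤ)
    (q : ∀ R : ι, (Fin (ar R) → X) → (Fin (ar R) → A) → ℤ) : Prop :=
  (∀ i a, w i a = 0 → r i a = 0) ∧
  (∀ R : ι, ∀ xb ∈ RX R, ∀ y ∈ RA R, p R xb y = 0 → q R xb y = 0)

/-- `f` is a polymorphism of the promise template given by relations `RA`, `RB`. -/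
def IsPolymorphism {ι : Type} {ar : ι → ℕ} {A B : Type}
    (RA : ∀ R : ι, Finset (Fin (ar R) → A)) (RB : ∀ R : ι, Finset (Fin (ar R) → B))
    {L : ℕ} (f : (Fin L → A) → B) : Prop :=
  ∀ R : ι, ∀ x : Fin L → (Fin (ar R) → A), (∀ l, x l ∈ RA R) →
    (fun k => f (fun l => x l k)) ∈ RB R

/-- `f` is block-symmetric with respect to the partition of `Fin L` into the
fibers of `blk`: it is invariant under all permutations preserving each fiber. -/
def IsBlockSymmetric {A B : Type} {L κ : ℕ} (blk : Fin L → Fin κ)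
    (f : (Fin L → A) → B) : Prop :=
  ∀ π : Equiv.Perm (Fin L), (∀ i, blk (π i) = blk i) →
    ∀ x : Fin L → A, f (x ∘ π) = f x

/-- Positive combinations of a rational vector with an integer vector supported on it: for large
`n`, some combination with total weight `n` is a vector of natural numbers. -/
theorem exists_natural_combination {T : Type*} [Fintype T] (u : T → ℚ) (s : T → ℤ)
    (hu : ∀ t, 0 ≤ u t) (hs : ∀ t, u t = 0 → s t = 0) :
    ∃ N : ℕ, ∀ n ≥ N, ∃ α β : ℚ, α + β = n ∧ ∀ t, ∃ m : ℕ, (m : ℚ) = α * u t + β * s t := by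
  set D : ℕ := ∏ t, (u t).den
  have hDpos : 0 < D := Finset.prod_pos fun t _ => (u t).den_pos
  have hint : ∀ t, ∃ k : ℤ, (k : ℚ) = D * u t := by
    intro t
    obtain ⟨c, hc⟩ : (u t).den ∣ D := Finset.dvd_prod_of_mem _ (Finset.mem_univ t)
    refine ⟨c * (u t).num, ?_⟩
    rw [hc]
    push_cast
    rw [← Rat.mul_den_eq_num (u t)]
    ring
  choose k hk using hint
  set M : ℕ := ∑ t, (s t).natAbs
  refine ⟨D * (D * M), fun n hn => ⟨D * (n / D : ℕ), (n % D : ℕ), ?_, fun t => ?_⟩⟩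
  · exact_mod_cast Nat.div_add_mod n D
  have hval : (D * (n / D : ℕ) : ℚ) * u t + (n % D : ℕ) * s t
      = (((n / D : ℕ) * k t + (n % D : ℕ) * s t : ℤ) : ℚ) := by
    simp only [Int.cast_add, Int.cast_mul, Int.cast_natCast, hk]
    ring
  suffices h : 0 ≤ ((n / D : ℕ) * k t + (n % D : ℕ) * s t : ℤ) by
    obtain ⟨m, hm⟩ := Int.eq_ofNat_of_zero_le h
    exact ⟨m, by rw [hval, hm]; norm_cast⟩
  have hDq : (0 : ℚ) < D := by exact_mod_cast hDpos
  rcases (hu t).eq_or_lt with h0 | hpos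
  · have : k t = 0 := by
      have := hk t
      rw [← h0, mul_zero] at this
      exact_mod_cast this
    simp [this, hs t h0.symm]
  · have hk1 : 1 ≤ k t := by
      have : (0 : ℚ) < k t := by rw [hk]; positivity
      have : 0 < k t := by exact_mod_cast this
      omega
    have hsM : (s t).natAbs ≤ M :=
      Finset.single_le_sum (f := fun t => (s t).natAbs) (fun _ _ => Nat.zero_le _)
        (Finset.mem_univ t)
    have hdiv : D * M ≤ n / D := (Nat.le_div_iff_mul_le hDpos).2 (by rwa [mul_comm])
    have hmod : n % D ≤ D := (Nat.mod_lt n hDpos).le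
    have h1 : ((n % D : ℕ) : ℤ) * -s t ≤ (n / D : ℕ) := by
      calc ((n % D : ℕ) : ℤ) * -s t ≤ (n % D : ℕ) * ((s t).natAbs : ℤ) := by
            gcongr
            omega
        _ ≤ (D * M : ℕ) := by
            exact_mod_cast Nat.mul_le_mul hmod hsM
        _ ≤ (n / D : ℕ) := by exact_mod_cast hdiv
    nlinarith [Int.natCast_nonneg (n / D)]

/-- A function with prescribed numbers of occurrences of each value in each block exists as soon
as these numbers add up to the block sizes. -/
theorem exists_card_fiber_eq {I β T : Type*} [Fintype I] [Fintype β] [DecidableEq β]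
    [Fintype T] [DecidableEq T] (blk : I → β) (c : β → T → ℕ)
    (hc : ∀ b, ∑ t, c b t = (Finset.univ.filter fun i => blk i = b).card) :
    ∃ x : I → T, ∀ b t, (Finset.univ.filter fun i => blk i = b ∧ x i = t).card = c b t := by
  have e (b : β) : {i // blk i = b} ≃ Σ t, Fin (c b t) :=
    Fintype.equivOfCardEq (by simp [hc, Fintype.card_subtype])
  refine ⟨fun i => (e (blk i) ⟨i, rfl⟩).1, fun b t => ?_⟩
  have e' : {i // blk i = b ∧ (e (blk i) ⟨i, rfl⟩).1 = t} ≃ Fin (c b t) :=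
    calc {i // blk i = b ∧ (e (blk i) ⟨i, rfl⟩).1 = t}
        ≃ {j : {i // blk i = b} // (e b j).1 = t} :=
          { toFun := fun i => ⟨⟨i.1, i.2.1⟩, by obtain ⟨i, rfl, h⟩ := i; exact h⟩
            invFun := fun j => ⟨j.1.1, j.1.2, by obtain ⟨⟨i, rfl⟩, h⟩ := j; exact h⟩
            left_inv := fun _ => rfl
            right_inv := fun _ => rfl }
      _ ≃ {s : Σ t, Fin (c b t) // s.1 = t} := (e b).subtypeEquiv fun _ => Iff.rfl
      _ ≃ Fin (c b t) := Equiv.sigmaSubtype t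
  rw [← Fintype.card_subtype, Fintype.card_congr e', Fintype.card_fin]

/-- A block-symmetric function depends only on the numbers of occurrences of each value in each
block. -/
theorem IsBlockSymmetric.eq_of_card_eq {A B : Type} [DecidableEq A] {L κ : ℕ}
    {blk : Fin L → Fin κ} {f : (Fin L → A) → B} (hf : IsBlockSymmetric blk f) {x y : Fin L → A}
    (h : ∀ b a, (Finset.univ.filter fun i => blk i = b ∧ x i = a).card
      = (Finset.univ.filter fun i => blk i = b ∧ y i = a).card) : f x = f y := by
  have e (z : Fin κ × A) : {i // (blk i, x i) = z} ≃ {i // (blk i, y i) = z} :=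
    Fintype.equivOfCardEq (by simpa [Fintype.card_subtype, Prod.ext_iff] using h z.1 z.2)
  have hπ (i) : (blk (Equiv.ofFiberEquiv e i), y (Equiv.ofFiberEquiv e i)) = (blk i, x i) :=
    Equiv.ofFiberEquiv_map e i
  rw [← hf (Equiv.ofFiberEquiv e) (fun i => (Prod.ext_iff.1 (hπ i)).1) y]
  congr 1
  funext i
  exact (Prod.ext_iff.1 (hπ i)).2.symm

/-- If a promise template `(𝐀,𝐁)` over finite domains has
block-symmetric polymorphisms of arbitrarily high width, then for any instance `𝐗`, the
existence of a BLP solution together with a refining affine solution implies `𝐗 → 𝐁`. -/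
theorem stmt_2 {ι : Type} [Fintype ι] {ar : ι → ℕ} (har : ∀ R, 1 ≤ ar R)
    {A B : Type} [Fintype A] [DecidableEq A] [Fintype B]
    (RA : ∀ R : ι, Finset (Fin (ar R) → A))
    (RB : ∀ R : ι, Finset (Fin (ar R) → B))
    (hAB : ∃ h : A → B, IsHom RA RB h)
    (hblocks : ∀ N : ℕ, ∃ (L κ : ℕ) (blk : Fin L → Fin κ) (f : (Fin L → A) → B),
      (∀ b, N ≤ (Finset.univ.filter (fun i => blk i = b)).card) ∧
      IsPolymorphism RA RB f ∧ IsBlockSymmetric blk f)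
    {X : Type} [Fintype X]
    (RX : ∀ R : ι, Finset (Fin (ar R) → X))
    (w : X → A → ℚ) (p : ∀ R : ι, (Fin (ar R) → X) → (Fin (ar R) → A) → ℚ)
    (r : X → A → ℤ) (q : ∀ R : ι, (Fin (ar R) → X) → (Fin (ar R) → A) → ℤ)
    (hblp : IsBLPSol RX RA w p) (haff : IsAffSol RX RA r q)
    (href : Refines RX RA w p r q) :
    ∃ σ : X → B, IsHom RX RB σ := by
  obtain ⟨hw0, hp0, hw1, hp1, hpm⟩ := hblp
  obtain ⟨hr1, hq1, hqm⟩ := haff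
  obtain ⟨hwr, hpq⟩ := href
  let T := (X × A) ⊕ (Σ R, {xb // xb ∈ RX R} × {y // y ∈ RA R})
  let u : T → ℚ := Sum.elim (fun t => w t.1 t.2) (fun t => p t.1 t.2.1 t.2.2)
  let s : T → ℤ := Sum.elim (fun t => r t.1 t.2) (fun t => q t.1 t.2.1 t.2.2)
  obtain ⟨N, hN⟩ := exists_natural_combination u s
    (by rintro (⟨i, a⟩ | ⟨R, xb, y⟩)
        · exact hw0 i a
        · exact hp0 R xb xb.2 y y.2)
    (by rintro (⟨i, a⟩ | ⟨R, xb, y⟩)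
        · exact hwr i a
        · exact hpq R xb xb.2 y y.2)
  obtain ⟨L, κ, blk, f, hblk, hpol, hsym⟩ := hblocks N
  choose α β hαβ m hm using fun b => hN _ (hblk b)
  have hmw (b i a) : (m b (.inl (i, a)) : ℚ) = α b * w i a + β b * r i a := hm b _
  have hmp (b R xb y) : (m b (.inr ⟨R, xb, y⟩) : ℚ) = α b * p R xb y + β b * q R xb y := hm b _
  have hx (i : X) := exists_card_fiber_eq blk (fun b a => m b (.inl (i, a))) fun b => by
    have hr : ∑ a, (r i a : ℚ) = 1 := by exact_mod_cast hr1 i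
    rw [← Nat.cast_inj (R := ℚ), ← hαβ b]
    push_cast
    simp_rw [hmw, Finset.sum_add_distrib, ← Finset.mul_sum, hw1, hr, mul_one]
  choose x hx using hx
  refine ⟨fun i => f (x i), fun R xb hxb => ?_⟩
  obtain ⟨z, hz⟩ := exists_card_fiber_eq blk
    (fun b (y : {y // y ∈ RA R}) => m b (.inr ⟨R, ⟨xb, hxb⟩, y⟩)) fun b => by
      have hp : ∑ y : {y // y ∈ RA R}, p R xb y = 1 := by
        rw [Finset.sum_coe_sort (RA R) (p R xb), hp1 R xb hxb]
      have hq : ∑ y : {y // y ∈ RA R}, (q R xb y : ℚ) = 1 := by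
        rw [Finset.sum_coe_sort (RA R) fun y => (q R xb y : ℚ)]
        exact_mod_cast hq1 R xb hxb
      rw [← Nat.cast_inj (R := ℚ), ← hαβ b]
      push_cast
      simp_rw [hmp, Finset.sum_add_distrib, ← Finset.mul_sum, hp, hq, mul_one]
  convert hpol R (fun l => z l) (fun l => (z l).2) using 1
  funext k
  refine hsym.eq_of_card_eq fun b a => ?_
  rw [hx]
  have hcount : (Finset.univ.filter fun l => blk l = b ∧ (z l : Fin (ar R) → A) k = a).card
      = ∑ y : {y // y ∈ RA R} with y.1 k = a, m b (.inr ⟨R, ⟨xb, hxb⟩, y⟩) := by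
    rw [Finset.card_eq_sum_card_fiberwise (f := z)
      (t := Finset.univ.filter fun y : {y // y ∈ RA R} => y.1 k = a) (by intro l; simp)]
    refine Finset.sum_congr rfl fun y hy => ?_
    rw [← hz, Finset.filter_filter]
    congr 1
    ext l
    simp only [Finset.mem_filter, Finset.mem_univ, true_and] at hy ⊢
    grind
  have hsum (g : (Fin (ar R) → A) → ℚ) :
      ∑ y : {y // y ∈ RA R} with y.1 k = a, g y = ∑ y ∈ RA R with y k = a, g y := by
    rw [Finset.sum_filter, Finset.sum_filter,
      Finset.sum_coe_sort (RA R) fun y => if y k = a then g y else 0]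
  have hqk : ∑ y ∈ RA R with y k = a, (q R xb y : ℚ) = r (xb k) a := by
    exact_mod_cast hqm R xb hxb k a
  rw [hcount, ← Nat.cast_inj (R := ℚ)]
  push_cast
  simp_rw [hmw, hmp, Finset.sum_add_distrib, ← Finset.mul_sum, hsum, hpm R xb hxb k a]
  rw [hsum fun y => (q R xb y : ℚ), hqk]
end

section
/- Let (𝐀,𝐁) be a promise template. The BLP+Affine algorithm correctly solves PCSP-Decision(𝐀,𝐁) if and only if the minion 𝓜_{BLP+Aff} admits a minion homomorphism to the minion Pol(𝐀,𝐁). -/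
/-- The BLP+Affine algorithm accepts the instance `RX` (with respect to `RA`):
there is a BLP solution together with an affine solution refining it. -/
def Accepts {ι : Type} {ar : ι → ℕ} {X A : Type} [Fintype A] [DecidableEq A]
    (RX : ∀ R : ι, Finset (Fin (ar R) → X))
    (RA : ∀ R : ι, Finset (Fin (ar R) → A)) : Prop :=
  ∃ w p r q, IsBLPSol RX RA w p ∧ IsAffSol RX RA r q ∧ Refines RX RA w p r q

/-- An abstract minion: a family of sets indexed by arity, with minor operations. -/
structure Minion where
  carrier : ℕ → Type
  map : ∀ {L L' : ℕ}, (Fin L → Fin L') → carrier L → carrier L'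
  map_id : ∀ (L : ℕ) (f : carrier L), map id f = f
  map_comp : ∀ {L L' L'' : ℕ} (π : Fin L → Fin L') (τ : Fin L' → Fin L'')
    (f : carrier L), map τ (map π f) = map (τ ∘ π) f

/-- A minion homomorphism: preserves arities and minors. -/
structure MinionHom (M N : Minion) where
  toFun : ∀ L, M.carrier L → N.carrier L
  map_minor : ∀ {L L' : ℕ} (π : Fin L → Fin L') (f : M.carrier L),
    toFun L' (M.map π f) = N.map π (toFun L f)

/-- The defining conditions of an `L`-ary object `(w, r)` of the minion `𝓜_{BLP+Aff}`. -/
def BLPAffCond (L : ℕ) (w : Fin L → ℚ) (r : Fin L → ℤ) : Prop :=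
  (∀ i, 0 ≤ w i) ∧ (∑ i, w i = 1) ∧ (∑ i, r i = 1) ∧ (∀ i, w i = 0 → r i = 0)

/-- The minion `𝓜_{BLP+Aff}`. -/
def MBLPAff : Minion where
  carrier L := {wr : (Fin L → ℚ) × (Fin L → ℤ) // BLPAffCond L wr.1 wr.2}
  map {L L'} π wr :=
    ⟨(fun i => ∑ j ∈ Finset.univ.filter (fun j => π j = i), wr.1.1 j,
      fun i => ∑ j ∈ Finset.univ.filter (fun j => π j = i), wr.1.2 j), by
      obtain ⟨hw0, hw1, hr1, hz⟩ := wr.2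
      refine ⟨fun i => Finset.sum_nonneg fun j _ => hw0 j, ?_, ?_, ?_⟩
      · exact (Finset.sum_fiberwise Finset.univ π wr.1.1).trans hw1
      · exact (Finset.sum_fiberwise Finset.univ π wr.1.2).trans hr1
      · intro i hi
        have hw' : ∑ j ∈ Finset.univ.filter (fun j => π j = i), wr.1.1 j = 0 := hi
        exact Finset.sum_eq_zero fun j hj =>
          hz j ((Finset.sum_eq_zero_iff_of_nonneg fun j _ => hw0 j).1 hw' j hj)⟩
  map_id := by
    intro L f
    apply Subtype.ext
    refine Prod.ext ?_ ?_ <;> funext i <;>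
      simp [Finset.sum_filter, Finset.sum_ite_eq']
  map_comp := by
    intro L L' L'' π τ f
    apply Subtype.ext
    refine Prod.ext ?_ ?_ <;> funext i <;>
    · show ∑ i' ∈ Finset.univ.filter (fun i' => τ i' = i),
        ∑ j ∈ Finset.univ.filter (fun j => π j = i'), _ = _
      have hset : (Finset.univ.filter
          (fun j => π j ∈ Finset.univ.filter (fun i' => τ i' = i)))
          = Finset.univ.filter (fun j => τ (π j) = i) := by
        ext j; simp
      rw [Finset.sum_fiberwise_eq_sum_filter Finset.univ
        (Finset.univ.filter (fun i' => τ i' = i)) π _, hset]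
      rfl

/-- The polymorphism minion `Pol(𝐀,𝐁)`. -/
def PolMinion {ι : Type} {ar : ι → ℕ} {A B : Type}
    (RA : ∀ R : ι, Finset (Fin (ar R) → A)) (RB : ∀ R : ι, Finset (Fin (ar R) → B)) :
    Minion where
  carrier L := {f : (Fin L → A) → B // IsPolymorphism RA RB f}
  map {L L'} π f := ⟨fun x => f.1 (x ∘ π),
    fun R x hx => f.2 R (fun l => x (π l)) (fun l => hx (π l))⟩
  map_id := fun _ _ => rfl
  map_comp := fun _ _ _ => rfl

/-- The minor map sending an enumerated tuple of `RA R` to its `k`-th entry. -/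
noncomputable def coordMinor {ι : Type} {ar : ι → ℕ} {A : Type} [Fintype A]
    (RA : ∀ R : ι, Finset (Fin (ar R) → A)) (R : ι) (k : Fin (ar R)) :
    Fin (RA R).card → Fin (Fintype.card A) :=
  fun j => Fintype.equivFin A (((RA R).equivFin.symm j).1 k)

/-- The relation `R` of the free structure of the minion `M` generated by the structure `RA`. -/
def FreeRel {ι : Type} {ar : ι → ℕ} {A : Type} [Fintype A] (M : Minion)
    (RA : ∀ R : ι, Finset (Fin (ar R) → A)) (R : ι)
    (t : Fin (ar R) → M.carrier (Fintype.card A)) : Prop :=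
  ∃ m : M.carrier (RA R).card, ∀ k, t k = M.map (coordMinor RA R k) m

/-- Minion homomorphisms to `Pol(𝐀,𝐁)` correspond to homomorphisms from the free structure
to `𝐁`. -/
theorem nonempty_minionHom_polMinion_iff {ι : Type} {ar : ι → ℕ} {A B : Type} [Fintype A]
    (M : Minion) (RA : ∀ R : ι, Finset (Fin (ar R) → A))
    (RB : ∀ R : ι, Finset (Fin (ar R) → B)) :
    Nonempty (MinionHom M (PolMinion RA RB)) ↔
      ∃ σ : M.carrier (Fintype.card A) → B,
        ∀ R t, FreeRel M RA R t → (fun k => σ (t k)) ∈ RB R := by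
  constructor
  · rintro ⟨ξ⟩
    refine ⟨fun m => (ξ.toFun _ m).1 (Fintype.equivFin A).symm, ?_⟩
    rintro R t ⟨m, hm⟩
    have key := (ξ.toFun _ m).2 R (fun j => ((RA R).equivFin.symm j).1)
      (fun j => ((RA R).equivFin.symm j).2)
    convert key using 2 with k
    have hcoord : (Fintype.equivFin A).symm ∘ coordMinor RA R k =
        fun j => ((RA R).equivFin.symm j).1 k := by
      funext j
      simp [coordMinor]
    have hξ := congrArg (fun g => g.1 (Fintype.equivFin A).symm)
      (ξ.map_minor (coordMinor RA R k) m)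
    rw [← hm k] at hξ
    exact hξ.trans (congrArg (ξ.toFun _ m).1 hcoord)
  · rintro ⟨σ, hσ⟩
    refine ⟨⟨fun L f => ⟨fun x => σ (M.map (fun l => Fintype.equivFin A (x l)) f), ?_⟩, ?_⟩⟩
    · intro R x hx
      refine hσ R _ ⟨M.map (fun l => (RA R).equivFin ⟨x l, hx l⟩) f, fun k => ?_⟩
      rw [M.map_comp]
      refine congrArg (fun π => M.map π f) ?_
      funext l
      simp [coordMinor]
    · intro L L' π f
      apply Subtype.ext
      funext x
      change σ (M.map _ (M.map π f)) = σ (M.map _ f)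
      rw [M.map_comp]
      rfl

/-- Summing over a fibre of `coordMinor` amounts to summing over the tuples with a given entry. -/
theorem sum_filter_coordMinor {ι : Type} {ar : ι → ℕ} {A : Type} [Fintype A] [DecidableEq A]
    {N : Type} [AddCommMonoid N] (RA : ∀ R : ι, Finset (Fin (ar R) → A)) (R : ι)
    (k : Fin (ar R)) (i : Fin (Fintype.card A)) (g : Fin (RA R).card → N)
    (f : (Fin (ar R) → A) → N) (hg : ∀ y : RA R, g ((RA R).equivFin y) = f y) :
    ∑ j ∈ Finset.univ.filter (fun j => coordMinor RA R k j = i), g j =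
      ∑ y ∈ (RA R).filter (fun y => y k = (Fintype.equivFin A).symm i), f y := by
  rw [Finset.sum_filter, Finset.sum_filter, ← Finset.sum_coe_sort (RA R),
    ← Equiv.sum_comp (RA R).equivFin]
  refine Finset.sum_congr rfl fun y _ => ?_
  simp [coordMinor, hg, Equiv.eq_symm_apply]

/-- Summing over the enumeration of a finset amounts to summing over the finset. -/
theorem sum_equivFin_comp {α N : Type} [AddCommMonoid N] (s : Finset α)
    (g : Fin s.card → N) (f : α → N) (hg : ∀ y : s, g (s.equivFin y) = f y) :
    ∑ j, g j = ∑ y ∈ s, f y := by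
  rw [← Finset.sum_coe_sort s, ← Equiv.sum_comp s.equivFin]
  exact Finset.sum_congr rfl fun y _ => hg y

/-- Tuples of the free structure of `𝓜_{BLP+Aff}` are the tuples of marginals of a pair of weight
functions on `RA R`. -/
theorem freeRel_MBLPAff_iff {ι : Type} {ar : ι → ℕ} {A : Type} [Fintype A] [DecidableEq A]
    (RA : ∀ R : ι, Finset (Fin (ar R) → A)) (R : ι)
    (t : Fin (ar R) → MBLPAff.carrier (Fintype.card A)) :
    FreeRel MBLPAff RA R t ↔
      ∃ (p : (Fin (ar R) → A) → ℚ) (q : (Fin (ar R) → A) → ℤ),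
        (∀ y ∈ RA R, 0 ≤ p y) ∧ (∑ y ∈ RA R, p y = 1) ∧ (∑ y ∈ RA R, q y = 1) ∧
        (∀ y ∈ RA R, p y = 0 → q y = 0) ∧
        (∀ k a, ∑ y ∈ (RA R).filter (fun y => y k = a), p y =
          (t k).1.1 (Fintype.equivFin A a)) ∧
        (∀ k a, ∑ y ∈ (RA R).filter (fun y => y k = a), q y =
          (t k).1.2 (Fintype.equivFin A a)) := by
  constructor
  · rintro ⟨⟨⟨u, v⟩, hu, hu1, hv1, huv⟩, hm⟩
    dsimp only at hu hu1 hv1 huv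
    obtain ⟨p, hp⟩ : ∃ p : (Fin (ar R) → A) → ℚ, ∀ y : RA R, u ((RA R).equivFin y) = p y :=
      ⟨fun y => if h : y ∈ RA R then u ((RA R).equivFin ⟨y, h⟩) else 0, by simp⟩
    obtain ⟨q, hq⟩ : ∃ q : (Fin (ar R) → A) → ℤ, ∀ y : RA R, v ((RA R).equivFin y) = q y :=
      ⟨fun y => if h : y ∈ RA R then v ((RA R).equivFin ⟨y, h⟩) else 0, by simp⟩
    refine ⟨p, q, fun y hy => hp ⟨y, hy⟩ ▸ hu _, (sum_equivFin_comp _ u p hp).symm.trans hu1,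
      (sum_equivFin_comp _ v q hq).symm.trans hv1, fun y hy => ?_, fun k a => ?_, fun k a => ?_⟩
    · rw [← hp ⟨y, hy⟩, ← hq ⟨y, hy⟩]
      exact huv _
    · rw [hm k]
      have hsum := sum_filter_coordMinor RA R k (Fintype.equivFin A a) u p hp
      rw [Equiv.symm_apply_apply] at hsum
      exact hsum.symm
    · rw [hm k]
      have hsum := sum_filter_coordMinor RA R k (Fintype.equivFin A a) v q hq
      rw [Equiv.symm_apply_apply] at hsum
      exact hsum.symm
  · rintro ⟨p, q, hp, hp1, hq1, hpq, hpm, hqm⟩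
    refine ⟨⟨(fun j => p ((RA R).equivFin.symm j).1, fun j => q ((RA R).equivFin.symm j).1),
      fun j => hp _ ((RA R).equivFin.symm j).2, ?_, ?_,
      fun j => hpq _ ((RA R).equivFin.symm j).2⟩, fun k => ?_⟩
    · exact (sum_equivFin_comp _ _ p fun y => by simp).trans hp1
    · exact (sum_equivFin_comp _ _ q fun y => by simp).trans hq1
    · refine Subtype.ext (Prod.ext (funext fun i => ?_) (funext fun i => ?_))
      · have := hpm k ((Fintype.equivFin A).symm i)
        rw [Equiv.apply_symm_apply] at this
        rw [← this]
        exact (sum_filter_coordMinor RA R k i _ p fun y => by simp).symm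
      · have := hqm k ((Fintype.equivFin A).symm i)
        rw [Equiv.apply_symm_apply] at this
        rw [← this]
        exact (sum_filter_coordMinor RA R k i _ q fun y => by simp).symm

/-- BLP+Affine accepts exactly the instances mapping to the free structure of `𝓜_{BLP+Aff}`. -/
theorem accepts_iff_exists_freeRel {ι : Type} {ar : ι → ℕ} {X A : Type} [Fintype A]
    [DecidableEq A] (RX : ∀ R : ι, Finset (Fin (ar R) → X))
    (RA : ∀ R : ι, Finset (Fin (ar R) → A)) :
    Accepts RX RA ↔ ∃ h : X → MBLPAff.carrier (Fintype.card A),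
      ∀ R, ∀ t ∈ RX R, FreeRel MBLPAff RA R (fun k => h (t k)) := by
  constructor
  · rintro ⟨w, p, r, q, ⟨hw, hp, hw1, hp1, hpm⟩, ⟨hr1, hq1, hqm⟩, hwr, hpq⟩
    refine ⟨fun i => ⟨(fun j => w i ((Fintype.equivFin A).symm j),
      fun j => r i ((Fintype.equivFin A).symm j)), fun j => hw _ _,
      (Equiv.sum_comp _ _).trans (hw1 i), (Equiv.sum_comp _ _).trans (hr1 i),
      fun j => hwr _ _⟩, fun R t ht => ?_⟩
    refine (freeRel_MBLPAff_iff RA R _).2 ⟨p R t, q R t, hp R t ht, hp1 R t ht, hq1 R t ht, hpq R t ht,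
      fun k a => ?_, fun k a => ?_⟩
    · simpa using hpm R t ht k a
    · simpa using hqm R t ht k a
  · rintro ⟨h, hh⟩
    simp only [freeRel_MBLPAff_iff] at hh
    classical
    have hh' : ∀ (R : ι) (t : Fin (ar R) → X),
        ∃ (p : (Fin (ar R) → A) → ℚ) (q : (Fin (ar R) → A) → ℤ), t ∈ RX R → _ := fun R t =>
      if ht : t ∈ RX R then
        let ⟨p, q, hpq⟩ := hh R t ht
        ⟨p, q, fun _ => hpq⟩
      else ⟨0, 0, fun h => absurd h ht⟩
    choose p q hpq using hh'
    refine ⟨fun i a => (h i).1.1 (Fintype.equivFin A a), p,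
      fun i a => (h i).1.2 (Fintype.equivFin A a), q,
      ⟨fun i a => (h i).2.1 _, fun R t ht => (hpq R t ht).1,
        fun i => (Equiv.sum_comp _ _).trans (h i).2.2.1, fun R t ht => (hpq R t ht).2.1,
        fun R t ht => (hpq R t ht).2.2.2.2.1⟩,
      ⟨fun i => (Equiv.sum_comp _ _).trans (h i).2.2.2.1, fun R t ht => (hpq R t ht).2.2.1,
        fun R t ht => (hpq R t ht).2.2.2.2.2⟩,
      fun i a => (h i).2.2.2.2 _, fun R t ht => (hpq R t ht).2.2.2.1⟩

/-- The BLP+Affine algorithm accepts every instance that maps to the template. -/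
theorem accepts_of_isHom {ι : Type} {ar : ι → ℕ} {X A : Type} [Fintype A] [DecidableEq A]
    (RX : ∀ R : ι, Finset (Fin (ar R) → X)) (RA : ∀ R : ι, Finset (Fin (ar R) → A))
    {σ : X → A} (hσ : IsHom RX RA σ) : Accepts RX RA := by
  let e : MBLPAff.carrier 1 := ⟨(fun _ => 1, fun _ => 1), by simp [BLPAffCond]⟩
  rw [accepts_iff_exists_freeRel]
  refine ⟨fun i => MBLPAff.map (fun _ => Fintype.equivFin A (σ i)) e, fun R t ht =>
    ⟨MBLPAff.map (fun _ => (RA R).equivFin ⟨_, hσ R t ht⟩) e, fun k => ?_⟩⟩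
  rw [MBLPAff.map_comp]
  refine congrArg (fun π => MBLPAff.map π e) ?_
  funext l
  simp [coordMinor]

/-- Compactness: a possibly infinite relational structure maps to a finite one
as soon as all its finite substructures do. -/
theorem exists_hom_of_finite_substructures {ι : Type} {ar : ι → ℕ} {D B : Type} [Finite B]
    (RD : ∀ R : ι, (Fin (ar R) → D) → Prop) (RB : ∀ R : ι, Finset (Fin (ar R) → B))
    (H : ∀ S : Finset D, ∃ σ : S → B, ∀ R (t : Fin (ar R) → S),
      RD R (fun k => (t k).1) → (fun k => σ (t k)) ∈ RB R) :
    ∃ σ : D → B, ∀ R t, RD R t → (fun k => σ (t k)) ∈ RB R := by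
  classical
  choose σ hσ using H
  obtain ⟨χ, hχ⟩ := Finset.rado_selection (β := fun _ : D => B) fun S d =>
    if h : d ∈ S then σ S ⟨d, h⟩ else σ {d} ⟨d, Finset.mem_singleton_self d⟩
  refine ⟨χ, fun R t ht => ?_⟩
  obtain ⟨S, hS, hχS⟩ := hχ (Finset.univ.image t)
  have hmem : ∀ k, t k ∈ S := fun k => hS (Finset.mem_image_of_mem t (Finset.mem_univ k))
  convert hσ S R (fun k => ⟨t k, hmem k⟩) ht using 2 with k
  rw [hχS _ (Finset.mem_image_of_mem t (Finset.mem_univ k)), dif_pos (hmem k)]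

/-- The BLP+Affine algorithm correctly solves `PCSP-Decision(𝐀,𝐁)` iff
the minion `𝓜_{BLP+Aff}` admits a minion homomorphism to `Pol(𝐀,𝐁)`. -/
theorem stmt_4 {ι : Type} [Fintype ι] {ar : ι → ℕ} (har : ∀ R, 1 ≤ ar R)
    {A B : Type} [Fintype A] [DecidableEq A] [Fintype B]
    (RA : ∀ R : ι, Finset (Fin (ar R) → A))
    (RB : ∀ R : ι, Finset (Fin (ar R) → B))
    (hAB : ∃ h : A → B, IsHom RA RB h) :
    (∀ (X : Type) [Fintype X] (RX : ∀ R : ι, Finset (Fin (ar R) → X)),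
        ((∃ σ : X → A, IsHom RX RA σ) → Accepts RX RA) ∧
        (Accepts RX RA → ∃ σ : X → B, IsHom RX RB σ)) ↔
      Nonempty (MinionHom MBLPAff (PolMinion RA RB)) := by
  rw [nonempty_minionHom_polMinion_iff]
  constructor
  · intro H
    refine exists_hom_of_finite_substructures (FreeRel MBLPAff RA) RB fun S => ?_
    classical
    obtain ⟨σ, hσ⟩ := (H S fun R => Finset.univ.filter fun t : Fin (ar R) → S =>
      FreeRel MBLPAff RA R fun k => (t k).1).2
      ((accepts_iff_exists_freeRel _ _).2 ⟨Subtype.val, fun R t ht => (Finset.mem_filter.1 ht).2⟩)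
    exact ⟨σ, fun R t ht => hσ R t (Finset.mem_filter.2 ⟨Finset.mem_univ t, ht⟩)⟩
  · rintro ⟨σ, hσ⟩ X _ RX
    refine ⟨fun ⟨_, hτ⟩ => accepts_of_isHom RX RA hτ, fun hX => ?_⟩
    obtain ⟨h, hh⟩ := (accepts_iff_exists_freeRel RX RA).1 hX
    exact ⟨fun i => σ (h i), fun R t ht => hσ R _ (hh R t ht)⟩
end

section
/- Let (𝐀,𝐁) be a promise template over finite domains and let f : A^L → B be a polymorphism of (𝐀,𝐁) that is block-symmetric with respect to a partition of [L] into blocks B_1,…,B_κ. Let 𝐗 be an instance. Suppose we are given, for each block index b ∈ [κ] and each variable i, nonnegative integers W_{b,i}(a) for a ∈ A with Σ_{a∈A} W_{b,i}(a) = |B_b|, and, for each b ∈ [κ] and each constraint j = (R_j, x̄^j), nonnegative integers P_{b,j}(y) for y ∈ R_j^𝐀 with Σ_{y∈R_j^𝐀} P_{b,j}(y) = |B_b|, such that W_{b,i}(a) = Σ_{y∈R_j^𝐀 : y|_i = a} P_{b,j}(y) whenever variable i occurs in constraint j. Then for any choice of tuples t_i ∈ A^L in which, within each block B_b, each a ∈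 A occurs exactly W_{b,i}(a) times, the map sending variable i to f(t_i) is a homomorphism from 𝐗 to 𝐁. -/
/-- Two functions whose fibers have the same sizes differ by a permutation of the domain. -/
theorem exists_perm_comp_eq_of_card_fiber_eq {α γ : Type*} [Fintype α] [DecidableEq γ]
    (u v : α → γ)
    (h : ∀ c, (Finset.univ.filter (fun l => u l = c)).card =
      (Finset.univ.filter (fun l => v l = c)).card) :
    ∃ π : Equiv.Perm α, ∀ l, v (π l) = u l := by
  have e : ∀ c, Nonempty ({l // u l = c} ≃ {l // v l = c}) := fun c =>
    ⟨Fintype.equivOfCardEq (by simpa only [Fintype.card_subtype] using h c)⟩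
  exact ⟨Equiv.ofFiberEquiv fun c => (e c).some, Equiv.ofFiberEquiv_map _⟩

/-- Nonnegative integer weights on `S` whose sum over each block is the size of the block
are the histograms of an `S`-valued function. -/
theorem exists_map_with_block_histogram {α β Y : Type*} [Fintype α] [DecidableEq β]
    [DecidableEq Y] (blk : α → β) (S : Finset Y) (P : β → Y → ℕ)
    (hP : ∀ b, ∑ y ∈ S, P b y = (Finset.univ.filter (fun l => blk l = b)).card) :
    ∃ g : α → Y, (∀ l, g l ∈ S) ∧ ∀ b, ∀ y ∈ S,
      (Finset.univ.filter (fun l => blk l = b ∧ g l = y)).card = P b y := by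
  let e : ∀ b, {l // blk l = b} ≃ Σ y : S, Fin (P b y) := fun b =>
    Fintype.equivOfCardEq (by
      rw [Fintype.card_subtype, ← hP b, Fintype.card_sigma]
      simp only [Fintype.card_fin]
      exact (Finset.sum_coe_sort S (P b)).symm)
  refine ⟨fun l => (e (blk l) ⟨l, rfl⟩).1, fun l => (e (blk l) ⟨l, rfl⟩).1.2, ?_⟩
  intro b y hy
  rw [← Fintype.card_fin (P b y), ← Finset.card_univ]
  symm
  refine Finset.card_bij (fun i _ => ((e b).symm ⟨⟨y, hy⟩, i⟩).1) ?_ ?_ ?_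
  · intro i _
    have key : ∀ x : {l // blk l = b}, (e (blk x.1) ⟨x.1, rfl⟩).1 = (e b x).1 := by
      rintro ⟨l, rfl⟩
      rfl
    simp only [Finset.mem_filter, Finset.mem_univ, true_and]
    exact ⟨((e b).symm ⟨⟨y, hy⟩, i⟩).2, by rw [key, Equiv.apply_symm_apply]⟩
  · intro i _ j _ hij
    simpa using (e b).symm.injective (Subtype.ext hij)
  · intro l hl
    simp only [Finset.mem_filter, Finset.mem_univ, true_and] at hl
    obtain ⟨rfl, rfl⟩ := hl
    exact ⟨(e (blk l) ⟨l, rfl⟩).2, Finset.mem_univ _,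
      congrArg Subtype.val ((e (blk l)).symm_apply_apply ⟨l, rfl⟩)⟩

/-- A block-symmetric function only depends on the histogram of its argument in each block. -/
theorem IsBlockSymmetric.apply_eq_of_card_eq {A B : Type} [DecidableEq A] {L κ : ℕ}
    {blk : Fin L → Fin κ} {f : (Fin L → A) → B} (hf : IsBlockSymmetric blk f)
    {u v : Fin L → A}
    (h : ∀ b a, (Finset.univ.filter (fun l => blk l = b ∧ u l = a)).card =
      (Finset.univ.filter (fun l => blk l = b ∧ v l = a)).card) : f u = f v := by
  obtain ⟨π, hπ⟩ := exists_perm_comp_eq_of_card_fiber_eq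
    (fun l => (blk l, u l)) (fun l => (blk l, v l)) (fun c => by
      simpa only [Prod.ext_iff] using h c.1 c.2)
  simp only [Prod.ext_iff] at hπ
  rw [← hf π (fun l => (hπ l).1) v]
  exact congrArg f (funext fun l => (hπ l).2.symm)

/-- Rounding with a block-symmetric polymorphism: if for every block
`b` the integer weights `W b`, `P b` satisfy the BLP-style marginal equations with total
mass the size of block `b`, and each tuple `t i` realizes within each block `b` the
histogram `W b i`, then `i ↦ f (t i)` is a homomorphism to `𝐁`. -/
theorem stmt_9 {ι : Type} [Fintype ι] {ar : ι → ℕ} (har : ∀ R, 1 ≤ ar R)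
    {A B : Type} [Fintype A] [DecidableEq A] [Fintype B]
    (RA : ∀ R : ι, Finset (Fin (ar R) → A))
    (RB : ∀ R : ι, Finset (Fin (ar R) → B))
    (hAB : ∃ h : A → B, IsHom RA RB h)
    {L κ : ℕ} (blk : Fin L → Fin κ) (f : (Fin L → A) → B)
    (hpoly : IsPolymorphism RA RB f) (hbsym : IsBlockSymmetric blk f)
    {X : Type} [Fintype X]
    (RX : ∀ R : ι, Finset (Fin (ar R) → X))
    (W : Fin κ → X → A → ℕ)
    (hW : ∀ b i, ∑ a, W b i a = (Finset.univ.filter (fun l => blk l = b)).card)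
    (P : Fin κ → ∀ R : ι, (Fin (ar R) → X) → (Fin (ar R) → A) → ℕ)
    (hP : ∀ b, ∀ R : ι, ∀ xb ∈ RX R,
      ∑ y ∈ RA R, P b R xb y = (Finset.univ.filter (fun l => blk l = b)).card)
    (hmarg : ∀ b, ∀ R : ι, ∀ xb ∈ RX R, ∀ (k : Fin (ar R)) (a : A),
      ∑ y ∈ (RA R).filter (fun y => y k = a), P b R xb y = W b (xb k) a)
    (t : X → Fin L → A)
    (ht : ∀ i b a,
      (Finset.univ.filter (fun l => blk l = b ∧ t i l = a)).card = W b i a) :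
    IsHom RX RB (fun i => f (t i)) := by
  intro R xb hxb
  obtain ⟨g, hgS, hg⟩ := exists_map_with_block_histogram blk (RA R) (fun b => P b R xb)
    (fun b => hP b R xb hxb)
  have hft : ∀ k, f (t (xb k)) = f (fun l => g l k) := fun k => by
    refine hbsym.apply_eq_of_card_eq fun b a => ?_
    rw [ht, ← hmarg b R xb hxb k a,
      Finset.card_eq_sum_card_fiberwise (f := g) (t := (RA R).filter (fun y => y k = a))]
    · refine Finset.sum_congr rfl fun y hy => ?_
      obtain ⟨hyS, rfl⟩ := Finset.mem_filter.mp hy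
      rw [← hg b y hyS, Finset.filter_filter]
      congr 1
      ext l
      simp only [Finset.mem_filter, Finset.mem_univ, true_and]
      constructor
      · rintro ⟨hb, rfl⟩
        exact ⟨⟨hb, rfl⟩, rfl⟩
      · rintro ⟨⟨hb, -⟩, hl⟩
        exact ⟨hb, hl⟩
    · intro l hl
      simp only [Finset.coe_filter, Finset.mem_univ, true_and, Set.mem_ofPred_eq] at hl ⊢
      exact ⟨hgS l, hl.2⟩
  simp only [hft]
  exact hpoly R g hgS
end
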